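/- Let H be a minimal counterexample to the main theorem: a plane graph with Δ(H)=6, containing no subgraph isomorphic to a diamond or a house, in which every 6-vertex either is not incident with two 4-cycles sharing an edge or is not incident with three cycles of sizes p,q,ℓ for any {p,q,ℓ} ∈ {{3,4,4},{3,3,4}}, that is not totally 7-colorable, and that minimizes |V(H)|+|E(H)| among all such graphs. Then H has no (4,4,4)-face, i.e., no 3-face all three of whose incident vertices have degree 4. -/

import Mathlib

open SimpleGraph

/-- The degree of a vertex, as `Nat.card` of its neighbor set. -/
noncomputable def vdeg {V : Type*} (G : SimpleGraph V) (v : V) : ℕ :=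
  Nat.card (G.neighborSet v)

/-- `G` has maximum degree exactly `k`. -/
def MaxDegreeEq {V : Type*} (G : SimpleGraph V) (k : ℕ) : Prop :=
  (∀ v, vdeg G v ≤ k) ∧ ∃ v, vdeg G v = k

/-- `G` admits a total `k`-coloring: a coloring of vertices and edges with `k` colors such
that adjacent vertices get distinct colors, edges sharing an endpoint get distinct colors,
and each edge gets a color distinct from those of its endpoints. -/
def TotallyColorable {V : Type*} (G : SimpleGraph V) (k : ℕ) : Prop :=
  ∃ (cv : V → Fin k) (ce : Sym2 V → Fin k),
    (∀ ⦃u v⦄, G.Adj u v → cv u ≠ cv v) ∧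
    (∀ e₁ ∈ G.edgeSet, ∀ e₂ ∈ G.edgeSet, e₁ ≠ e₂ → (∃ x, x ∈ e₁ ∧ x ∈ e₂) →
      ce e₁ ≠ ce e₂) ∧
    (∀ ⦃u v⦄, G.Adj u v → ce s(u, v) ≠ cv u)

/-- The diamond: `K₄` minus one edge. -/
def diamondGraph : SimpleGraph (Fin 4) :=
  SimpleGraph.fromEdgeSet {s(0, 1), s(0, 2), s(0, 3), s(1, 2), s(1, 3)}

/-- The house: a `4`-cycle `1 2 3 4` and a triangle `0 1 4` sharing exactly the edge `{1,4}`
(equivalently, a `5`-cycle plus one chord). -/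
def houseGraph : SimpleGraph (Fin 5) :=
  SimpleGraph.fromEdgeSet {s(0, 1), s(1, 2), s(2, 3), s(3, 4), s(4, 0), s(1, 4)}

/-- `G` contains a (not necessarily induced) subgraph isomorphic to `H`. -/
def ContainsCopy {α β : Type*} (H : SimpleGraph α) (G : SimpleGraph β) : Prop :=
  ∃ f : α → β, Function.Injective f ∧ ∀ ⦃u v⦄, H.Adj u v → G.Adj (f u) (f v)

/-- `v` is incident with two distinct `4`-cycles of `G` that share an edge. -/
def TwoAdjacentFourCyclesAt {V : Type*} (G : SimpleGraph V) (v : V) : Prop :=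
  ∃ (c₁ c₂ : G.Walk v v), c₁.IsCycle ∧ c₂.IsCycle ∧ c₁.length = 4 ∧ c₂.length = 4 ∧
    {e | e ∈ c₁.edges} ≠ {e | e ∈ c₂.edges} ∧ ∃ e, e ∈ c₁.edges ∧ e ∈ c₂.edges

/-- `v` is incident with three pairwise distinct cycles of `G`, of lengths `p`, `q`, `ℓ`. -/
def ThreeCyclesAt {V : Type*} (G : SimpleGraph V) (v : V) (p q ℓ : ℕ) : Prop :=
  ∃ (c₁ c₂ c₃ : G.Walk v v), c₁.IsCycle ∧ c₂.IsCycle ∧ c₃.IsCycle ∧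
    c₁.length = p ∧ c₂.length = q ∧ c₃.length = ℓ ∧
    {e | e ∈ c₁.edges} ≠ {e | e ∈ c₂.edges} ∧
    {e | e ∈ c₁.edges} ≠ {e | e ∈ c₃.edges} ∧
    {e | e ∈ c₂.edges} ≠ {e | e ∈ c₃.edges}

/-- Every `6`-vertex of `G` is not incident with two `4`-cycles sharing an edge, or is not
incident with three cycles of sizes `p, q, ℓ` for any `{p,q,ℓ} ∈ {{3,4,4},{3,3,4}}`. -/
def Good6Vertices {V : Type*} (G : SimpleGraph V) : Prop :=
  ∀ v, vdeg G v = 6 →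
    (¬ TwoAdjacentFourCyclesAt G v) ∨
    (∀ p q ℓ : ℕ, (({p, q, ℓ} : Multiset ℕ) = {3, 4, 4} ∨ ({p, q, ℓ} : Multiset ℕ) = {3, 3, 4}) →
      ¬ ThreeCyclesAt G v p q ℓ)

/-- Reversal of darts, as a permutation. -/
def dartRev {V : Type*} (G : SimpleGraph V) : Equiv.Perm G.Dart :=
  Function.Involutive.toPerm SimpleGraph.Dart.symm SimpleGraph.Dart.symm_involutive

/-- A rotation system (combinatorial embedding) of `G`: a permutation of the darts whose
orbits are exactly the sets of darts emanating from each single vertex. -/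
structure RotationSystem {V : Type*} (G : SimpleGraph V) where
  σ : Equiv.Perm G.Dart
  tail_fixed : ∀ d : G.Dart, (σ d).fst = d.fst
  vertex_cycles : ∀ d d' : G.Dart, d.fst = d'.fst → σ.SameCycle d d'

namespace RotationSystem

variable {V : Type*} {G : SimpleGraph V}

/-- The face-tracing permutation of a rotation system. -/
def φ (R : RotationSystem G) : Equiv.Perm G.Dart :=
  R.σ * dartRev G

/-- Two darts lie on the same face iff they are in the same orbit of the face-tracing
permutation. -/
def faceSetoid (R : RotationSystem G) : Setoid G.Dart where
  r := R.φ.SameCycle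
  iseqv := ⟨fun d => Equiv.Perm.SameCycle.refl _ d, Equiv.Perm.SameCycle.symm,
    Equiv.Perm.SameCycle.trans⟩

/-- The faces of the embedding: orbits of the face-tracing permutation. -/
def Faces (R : RotationSystem G) : Type _ :=
  Quotient R.faceSetoid

/-- The number of faces of the embedding. -/
noncomputable def numFaces (R : RotationSystem G) : ℕ :=
  Nat.card R.Faces

/-- The darts of the face containing the dart `d`. -/
def faceDarts (R : RotationSystem G) (d : G.Dart) : Set G.Dart :=
  {d' | R.φ.SameCycle d d'}

/-- The degree (length of the boundary walk, cut edges counted twice) of the face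
containing the dart `d`. -/
noncomputable def faceDeg (R : RotationSystem G) (d : G.Dart) : ℕ :=
  (R.faceDarts d).ncard

/-- The vertex `v` is incident with the face containing the dart `d`. -/
def FaceIncident (R : RotationSystem G) (v : V) (d : G.Dart) : Prop :=
  ∃ d' ∈ R.faceDarts d, d'.fst = v

/-- A rotation system is a plane embedding when it satisfies Euler's formula
`|V| - |E| + |F| = 2` on each connected component, i.e. `|V| + |F| = |E| + 2c`. -/
def IsPlanarEmbedding [Fintype V] (R : RotationSystem G) : Prop :=
  Fintype.card V + R.numFaces = Nat.card G.edgeSet + 2 * Nat.card G.ConnectedComponent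

end RotationSystem

/-- A graph is planar if it admits a plane embedding. -/
def IsPlanar {V : Type*} [Fintype V] (G : SimpleGraph V) : Prop :=
  ∃ R : RotationSystem G, R.IsPlanarEmbedding

/-- Conditions (1), (2), (3) on graphs in Theorem 1: planar of maximum degree 6, with no
diamond and no house subgraph, and every 6-vertex not incident with two adjacent 4-cycles
or not incident with three cycles of sizes in `{{3,4,4},{3,3,4}}`. -/
def GoodGraph {V : Type*} [Fintype V] (G : SimpleGraph V) : Prop :=
  IsPlanar G ∧ MaxDegreeEq G 6 ∧ ¬ ContainsCopy diamondGraph G ∧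
    ¬ ContainsCopy houseGraph G ∧ Good6Vertices G

/-- `H` is a minimal counterexample to the main theorem: it satisfies conditions (1)–(3),
is not totally 7-colorable, and minimizes `|V| + |E|` among all such graphs. -/
def MinimalCounterexample {V : Type*} [Fintype V] (H : SimpleGraph V) : Prop :=
  GoodGraph H ∧ ¬ TotallyColorable H 7 ∧
    ∀ (n : ℕ) (G : SimpleGraph (Fin n)), GoodGraph G → ¬ TotallyColorable G 7 →
      Fintype.card V + Nat.card H.edgeSet ≤ n + Nat.card G.edgeSet

theorem pairs_choosable {ι C : Type*} [DecidableEq ι] [DecidableEq C] [Nonempty C] :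
    ∀ (n : ℕ) (s : Finset ι), s.card = n → ∀ (L : ι → Bool → Finset C),
      (∀ i ∈ s, ∀ b, n ≤ (L i b).card) →
      ∃ f : ι → Bool → C, (∀ i ∈ s, ∀ b, f i b ∈ L i b) ∧
        ∀ i ∈ s, ∀ j ∈ s, i ≠ j → ∀ b b', f i b ≠ f j b' := by
  intro n
  induction n with
  | zero =>
    intro s hs L hL
    rw [Finset.card_eq_zero] at hs
    subst hs
    exact ⟨fun _ _ => Classical.arbitrary C, by simp, by simp⟩
  | succ n ih =>
    intro s hs L hL
    by_cases hd : ∃ i ∈ s, ∃ c, c ∈ L i true ∧ c ∈ L i false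
    · obtain ⟨i, hi, c, hc1, hc2⟩ := hd
      obtain ⟨f, hf1, hf2⟩ := ih (s.erase i) (by rw [Finset.card_erase_of_mem hi, hs]; rfl)
        (fun j b => (L j b).erase c) (by
          intro j hj b
          have := hL j (Finset.mem_of_mem_erase hj) b
          have := Finset.pred_card_le_card_erase (s := L j b) (a := c)
          omega)
      refine ⟨fun j b => if j = i then c else f j b, ?_, ?_⟩
      · intro j hj b
        by_cases hji : j = i
        · subst hji
          cases b <;> simp [hc1, hc2]
        · have := hf1 j (Finset.mem_erase.2 ⟨hji, hj⟩) b
          simp [hji, Finset.mem_of_mem_erase this]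
      · intro j hj k hk hjk b b'
        by_cases hji : j = i
        · have hki : k ≠ i := fun h => hjk (hji.trans h.symm)
          have := hf1 k (Finset.mem_erase.2 ⟨hki, hk⟩) b'
          simp only [hji, hki, if_true, if_false]
          exact (Finset.ne_of_mem_erase this).symm
        · by_cases hki : k = i
          · have := hf1 j (Finset.mem_erase.2 ⟨hji, hj⟩) b
            simp only [hji, hki, if_true, if_false]
            exact (Finset.ne_of_mem_erase this)
          · simp only [hji, hki, if_false]
            exact hf2 j (Finset.mem_erase.2 ⟨hji, hj⟩) k (Finset.mem_erase.2 ⟨hki, hk⟩) hjk b b'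
    · push Not at hd
      have hall := (Finset.all_card_le_biUnion_card_iff_exists_injective
        (fun p : s × Bool => L p.1 p.2)).1 (by
          intro t
          by_cases hp : ∃ i : s, (i, true) ∈ t ∧ (i, false) ∈ t
          · obtain ⟨i, h1, h2⟩ := hp
            have hsub : L i true ∪ L i false ⊆ t.biUnion (fun p : s × Bool => L p.1 p.2) := by
              intro c hc
              rw [Finset.mem_union] at hc
              rw [Finset.mem_biUnion]
              rcases hc with hc | hc
              · exact ⟨_, h1, hc⟩
              · exact ⟨_, h2, hc⟩
            have hdis : Disjoint (L i true) (L i false) :=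
              Finset.disjoint_left.2 (fun c h h' => hd i i.2 c h h')
            have h3 := Finset.card_le_card hsub
            rw [Finset.card_union_of_disjoint hdis] at h3
            have h4 := hL i i.2 true
            have h5 := hL i i.2 false
            have h6 : t.card ≤ Fintype.card (s × Bool) := Finset.card_le_univ t
            simp [hs] at h6
            omega
          · rcases t.eq_empty_or_nonempty with rfl | ⟨q, hq⟩
            · simp
            · have h1 : t.card ≤ Fintype.card s := by
                rw [← Finset.card_univ]
                apply Finset.card_le_card_of_injOn (fun p => p.1) (by simp)
                rintro ⟨i, b⟩ hi ⟨j, b'⟩ hj hij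
                simp only at hij
                subst hij
                simp only [Finset.mem_coe] at hi hj
                by_contra hne
                apply hp
                refine ⟨i, ?_⟩
                cases b <;> cases b' <;> simp_all
              have h2 : L q.1 q.2 ⊆ t.biUnion (fun p : s × Bool => L p.1 p.2) := by
                intro c hc
                exact Finset.mem_biUnion.2 ⟨q, hq, hc⟩
              have h3 := Finset.card_le_card h2
              have h4 := hL q.1 q.1.2 q.2
              simp [hs] at h1
              omega)
      obtain ⟨f, hf1, hf2⟩ := hall
      refine ⟨fun i b => if h : i ∈ s then f (⟨i, h⟩, b) else Classical.arbitrary C, ?_, ?_⟩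
      · intro i hi b
        simp only [hi, dif_pos]
        exact hf2 (⟨i, hi⟩, b)
      · intro i hi j hj hij b b'
        simp only [hi, hj, dif_pos]
        intro h
        have := hf1 h
        simp at this
        exact hij this.1

theorem oct_choosable (L1 L2 L3 M1 M2 M3 : Finset (Fin 7)) (h1 : 3 ≤ L1.card) (h2 : 3 ≤ L2.card)
    (h3 : 3 ≤ L3.card) (k1 : 3 ≤ M1.card) (k2 : 3 ≤ M2.card) (k3 : 3 ≤ M3.card) :
    ∃ a1 ∈ L1, ∃ a2 ∈ L2, ∃ a3 ∈ L3, ∃ b1 ∈ M1, ∃ b2 ∈ M2, ∃ b3 ∈ M3,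
      a1 ≠ a2 ∧ a1 ≠ a3 ∧ a2 ≠ a3 ∧ b1 ≠ b2 ∧ b1 ≠ b3 ∧ b2 ≠ b3 ∧
      a1 ≠ b2 ∧ a1 ≠ b3 ∧ a2 ≠ b1 ∧ a2 ≠ b3 ∧ a3 ≠ b1 ∧ a3 ≠ b2 := by
  obtain ⟨f, hf, hg⟩ := pairs_choosable (ι := Fin 3) (C := Fin 7) 3 Finset.univ (by simp)
    (fun i b => if b then ![L1, L2, L3] i else ![M1, M2, M3] i) (by
      intro i _ b
      fin_cases i <;> cases b <;> simpa)
  have g : ∀ i j : Fin 3, i ≠ j → ∀ b b', f i b ≠ f j b' :=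
    fun i j => hg i (Finset.mem_univ _) j (Finset.mem_univ _)
  refine ⟨f 0 true, hf 0 (by simp) true, f 1 true, hf 1 (by simp) true, f 2 true,
    hf 2 (by simp) true, f 0 false, hf 0 (by simp) false, f 1 false, hf 1 (by simp) false,
    f 2 false, hf 2 (by simp) false, ?_⟩
  refine ⟨?_, ?_, ?_, ?_, ?_, ?_, ?_, ?_, ?_, ?_, ?_, ?_⟩ <;> exact g _ _ (by decide) _ _

theorem list_card (a b c d : Fin 7) : 3 ≤ ((Finset.univ : Finset (Fin 7)) \ {a, b, c, d}).card := by
  have h := Finset.le_card_sdiff ({a, b, c, d} : Finset (Fin 7)) Finset.univ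
  have h2 : ({a, b, c, d} : Finset (Fin 7)).card ≤ 4 := Finset.card_le_four
  simp only [Finset.card_univ, Fintype.card_fin] at h
  omega

theorem outer_nbrs {V : Type*} [Fintype V] (H : SimpleGraph V) (x y z : V) (hxy : H.Adj x y)
    (hxz : H.Adj x z) (hyz : y ≠ z) (h4 : vdeg H x = 4) :
    ∃ p q, ∀ w, H.Adj x w → w = y ∨ w = z ∨ w = p ∨ w = q := by
  classical
  have h : (H.neighborSet x).ncard = 4 := h4
  have e1 := Set.ncard_sdiff_singleton_add_one (s := H.neighborSet x) (a := y) hxy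
  have e2 := Set.ncard_sdiff_singleton_add_one (s := H.neighborSet x \ {y}) (a := z)
    ⟨hxz, fun h => hyz h.symm⟩
  have e3 : ((H.neighborSet x \ {y}) \ {z}).ncard = 2 := by omega
  obtain ⟨p, q, _, hpq⟩ := Set.ncard_eq_two.1 e3
  refine ⟨p, q, fun w hw => ?_⟩
  by_cases h1 : w = y
  · exact Or.inl h1
  by_cases h2 : w = z
  · exact Or.inr (Or.inl h2)
  have : w ∈ (H.neighborSet x \ {y}) \ {z} := ⟨⟨hw, h1⟩, h2⟩
  rw [hpq] at this
  exact Or.inr (Or.inr this)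

theorem extend_coloring {V : Type*} [Fintype V] (H : SimpleGraph V) (x y z : V)
    (hxy : H.Adj x y) (hyz : H.Adj y z) (hzx : H.Adj z x)
    (dx : vdeg H x = 4) (dy : vdeg H y = 4) (dz : vdeg H z = 4)
    (cv : V → Fin 7) (ce : Sym2 V → Fin 7)
    (hv : ∀ u v, H.Adj u v → s(u, v) ≠ s(x, y) → cv u ≠ cv v)
    (he : ∀ u v w, H.Adj u v → H.Adj u w → v ≠ w → s(u, v) ≠ s(x, y) → s(u, w) ≠ s(x, y) →
      ce s(u, v) ≠ ce s(u, w))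
    (hve : ∀ u v, H.Adj u v → s(u, v) ≠ s(x, y) → ce s(u, v) ≠ cv u) :
    TotallyColorable H 7 := by
  classical
  have nxy := hxy.ne
  have nyz := hyz.ne
  have nzx := hzx.ne
  obtain ⟨x1, x2, hx⟩ := outer_nbrs H x y z hxy hzx.symm nyz dx
  obtain ⟨y1, y2, hy⟩ := outer_nbrs H y z x hyz hxy.symm nzx dy
  obtain ⟨z1, z2, hz⟩ := outer_nbrs H z x y hzx hyz.symm nxy dz
  obtain ⟨a1, ha1, a2, ha2, a3, ha3, b1, hb1, b2, hb2, b3, hb3, q⟩ := oct_choosable _ _ _ _ _ _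
    (list_card (cv x1) (cv x2) (ce s(x, x1)) (ce s(x, x2)))
    (list_card (cv y1) (cv y2) (ce s(y, y1)) (ce s(y, y2)))
    (list_card (cv z1) (cv z2) (ce s(z, z1)) (ce s(z, z2)))
    (list_card (ce s(y, y1)) (ce s(y, y2)) (ce s(z, z1)) (ce s(z, z2)))
    (list_card (ce s(z, z1)) (ce s(z, z2)) (ce s(x, x1)) (ce s(x, x2)))
    (list_card (ce s(x, x1)) (ce s(x, x2)) (ce s(y, y1)) (ce s(y, y2)))
  simp only [Finset.mem_sdiff, Finset.mem_univ, true_and, Finset.mem_insert,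
    Finset.mem_singleton, not_or] at ha1 ha2 ha3 hb1 hb2 hb3
  have X : ∀ w, H.Adj x w → w ≠ y → w ≠ z → a1 ≠ cv w ∧ a1 ≠ ce s(x, w) ∧ b2 ≠ ce s(x, w) ∧
      b3 ≠ ce s(x, w) := by
    intro w hw h1 h2
    rcases hx w hw with h | h | rfl | rfl <;> tauto
  have Y : ∀ w, H.Adj y w → w ≠ z → w ≠ x → a2 ≠ cv w ∧ a2 ≠ ce s(y, w) ∧ b1 ≠ ce s(y, w) ∧
      b3 ≠ ce s(y, w) := by
    intro w hw h1 h2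
    rcases hy w hw with h | h | rfl | rfl <;> tauto
  have Z : ∀ w, H.Adj z w → w ≠ x → w ≠ y → a3 ≠ cv w ∧ a3 ≠ ce s(z, w) ∧ b1 ≠ ce s(z, w) ∧
      b2 ≠ ce s(z, w) := by
    intro w hw h1 h2
    rcases hz w hw with h | h | rfl | rfl <;> tauto
  clear ha1 ha2 ha3 hb1 hb2 hb3 hx hy hz dx dy dz
  obtain ⟨cv', hcv'⟩ : ∃ cv' : V → Fin 7, ∀ v, cv' v = if v = x then a1 else if v = y then a2
    else if v = z then a3 else cv v := ⟨_, fun _ => rfl⟩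
  obtain ⟨ce', hce'⟩ : ∃ ce' : Sym2 V → Fin 7, ∀ e, ce' e = if e = s(y, z) then b1
    else if e = s(z, x) then b2 else if e = s(x, y) then b3 else ce e := ⟨_, fun _ => rfl⟩
  simp only [ne_eq, Sym2.eq_iff] at hv he hve hce'
  have T : ∀ u v, ce s(u, v) = ce s(v, u) := fun u v => by rw [Sym2.eq_swap]
  have K : ∀ u v, ce' s(u, v) = if (u = y ∧ v = z ∨ u = z ∧ v = y) then b1
      else if (u = z ∧ v = x ∨ u = x ∧ v = z) then b2
      else if (u = x ∧ v = y ∨ u = y ∧ v = x) then b3 else ce s(u, v) := by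
    intro u v
    rw [hce']
    simp only [Sym2.eq_iff]
  have E : ∀ u v w, H.Adj u v → H.Adj u w → v ≠ w → ce' s(u, v) ≠ ce' s(u, w) := by
    intro u v w h1 h2 h3
    have i1 := h1.ne
    have i2 := h2.ne
    have := he u v w h1 h2 h3
    rw [K, K]
    clear hce' K hv he hve T hcv'
    by_cases ux : u = x
    · subst ux
      have := X v h1
      have := X w h2
      clear X Y Z
      grind
    by_cases uy : u = y
    · subst uy
      have := Y v h1
      have := Y w h2
      clear X Y Z
      grind
    by_cases uz : u = z
    · subst uz
      have := Z v h1
      have := Z w h2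
      clear X Y Z
      grind
    clear X Y Z
    simp only [ux, uy, uz, false_and, or_self, if_false]
    exact this (by simp [ux, uy]) (by simp [ux, uy])
  refine ⟨cv', ce', ?_, ?_, ?_⟩
  · intro u v h
    have i1 := h.ne
    have := hv u v h
    have h' := h.symm
    rw [hcv', hcv']
    clear hce' K hv he hve T hcv'
    grind
  · intro e₁ h1 e₂ h2 hne ⟨u, hu1, hu2⟩
    obtain ⟨v, rfl⟩ := hu1
    obtain ⟨w, rfl⟩ := hu2
    exact E u v w h1 h2 (fun h => hne (by rw [h]))
  · intro u v h
    have i1 := h.ne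
    have := hve u v h
    rw [hcv', K]
    clear hce' K hv he hve hcv' E
    by_cases ux : u = x
    · subst ux
      have := X v h
      clear X Y Z
      grind
    by_cases uy : u = y
    · subst uy
      have := Y v h
      clear X Y Z
      grind
    by_cases uz : u = z
    · subst uz
      have := Z v h
      clear X Y Z
      grind
    clear X Y Z
    simp only [ux, uy, uz, false_and, or_self, if_false]
    exact this (by simp [ux, uy])

theorem face_three {V : Type*} [Fintype V] (H : SimpleGraph V) (R : RotationSystem H) (d : H.Dart)
    (h : R.faceDeg d = 3) : R.φ (R.φ (R.φ d)) = d := by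
  classical
  have hne : R.φ d ≠ d := by
    intro he
    have h1 : (R.φ d).fst = d.snd := R.tail_fixed d.symm
    rw [he] at h1
    exact d.adj.ne h1
  have hc : (R.φ.cycleOf d).support.card = 3 := by
    rw [← h, RotationSystem.faceDeg, ← Set.ncard_coe_finset]
    congr 1
    ext d'
    rw [Finset.mem_coe, Equiv.Perm.mem_support_cycleOf_iff' hne]
    rfl
  have := Equiv.Perm.pow_mod_card_support_cycleOf_self_apply R.φ 3 d
  rw [hc] at this
  exact this.symm

theorem planar_delete {V W : Type*} [Fintype V] [Fintype W] (H : SimpleGraph V)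
    (G : SimpleGraph W) (e : W ≃ V) (a : H.Dart)
    (hG : ∀ p q, G.Adj p q ↔ H.Adj (e p) (e q) ∧ s(e p, e q) ≠ s(a.fst, a.snd))
    (R : RotationSystem H) (hR : R.IsPlanarEmbedding) (h3 : R.φ (R.φ (R.φ a)) = a)
    (hE : Nat.card H.edgeSet = Nat.card G.edgeSet + 1) :
    IsPlanar G := by
  classical
  have hfst : ∀ d, (R.φ d).fst = d.snd := fun d => R.tail_fixed d.symm
  obtain ⟨b, hb⟩ : ∃ b, b = a.symm := ⟨_, rfl⟩
  obtain ⟨d2, hd2⟩ : ∃ d, d = R.φ a := ⟨_, rfl⟩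
  obtain ⟨d3, hd3⟩ : ∃ d, d = R.φ d2 := ⟨_, rfl⟩
  have hd1 : R.φ d3 = a := by rw [hd3, hd2, h3]
  have f2 : d2.fst = a.snd := by rw [hd2, hfst]
  have f3 : d3.fst = d2.snd := by rw [hd3, hfst]
  have f1 : d3.snd = a.fst := by rw [← hfst, hd1]
  have bf : b.fst = a.snd := by rw [hb]; rfl
  have bs : b.snd = a.fst := by rw [hb]; rfl
  have na := a.adj.ne
  have n2 := d2.adj.ne
  have n3 := d3.adj.ne
  have hab : a ≠ b := by rintro rfl; exact na bf
  have h2a : d2 ≠ a := by intro h; rw [h] at f2; exact na f2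
  have h2b : d2 ≠ b := by intro h; rw [h] at f3; exact n3 (by rw [f3, f1, bs])
  have h3a : d3 ≠ a := by intro h; rw [h] at f1; exact na f1.symm
  have h3b : d3 ≠ b := by intro h; rw [h] at f3; exact n2 (by rw [← f3, f2, bf])
  have hφs : ∀ d : H.Dart, R.φ d = R.σ d.symm := fun d => rfl
  have hσa : R.σ a = R.φ b := by rw [hφs, hb, Dart.symm_symm]
  have hσb : R.σ b = R.φ a := by rw [hφs, hb]
  have hφbf : (R.φ b).fst = a.fst := by rw [hfst, bs]
  -- the modified rotation
  obtain ⟨P, hP⟩ : ∃ P : Equiv.Perm H.Dart,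
      P = Equiv.swap b (R.σ b) * (Equiv.swap a (R.σ a) * R.σ) := ⟨_, rfl⟩
  have q1 : R.σ a ≠ b := by
    intro h; apply na; rw [← bf, ← h, R.tail_fixed]
  have q2 : R.σ b ≠ a := by
    intro h; apply na; rw [← bf, ← R.tail_fixed b, h]
  have q3 : R.σ a ≠ R.σ b := fun h => hab (R.σ.injective h)
  have Pa : P a = a := by
    simp only [hP, Equiv.Perm.mul_apply, Equiv.swap_apply_right]
    exact Equiv.swap_apply_of_ne_of_ne hab q2.symm
  have Pb : P b = b := by
    simp only [hP, Equiv.Perm.mul_apply]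
    rw [Equiv.swap_apply_of_ne_of_ne q2 q3.symm, Equiv.swap_apply_right]
  have P1 : ∀ d, R.σ d = a → d ≠ a → P d = R.σ a := by
    intro d h _
    simp only [hP, Equiv.Perm.mul_apply, h, Equiv.swap_apply_left]
    exact Equiv.swap_apply_of_ne_of_ne q1 q3
  have P2 : ∀ d, R.σ d = b → d ≠ b → P d = R.σ b := by
    intro d h _
    simp only [hP, Equiv.Perm.mul_apply, h]
    rw [Equiv.swap_apply_of_ne_of_ne hab.symm q1.symm, Equiv.swap_apply_left]
  have P0 : ∀ d, d ≠ a → d ≠ b → R.σ d ≠ a → R.σ d ≠ b → P d = R.σ d := by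
    intro d h1 h2 h3 h4
    simp only [hP, Equiv.Perm.mul_apply]
    rw [Equiv.swap_apply_of_ne_of_ne h3 (fun h => h1 (R.σ.injective h)),
      Equiv.swap_apply_of_ne_of_ne h4 (fun h => h2 (R.σ.injective h))]
  have Pmem : ∀ d, (P d ≠ a ∧ P d ≠ b) ↔ (d ≠ a ∧ d ≠ b) := by
    intro d
    have e1 : P d = a ↔ d = a := by
      constructor
      · intro h; exact P.injective (h.trans Pa.symm)
      · rintro rfl; exact Pa
    have e2 : P d = b ↔ d = b := by
      constructor
      · intro h; exact P.injective (h.trans Pb.symm)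
      · rintro rfl; exact Pb
    rw [Ne, Ne, e1, e2]
  have Pfst : ∀ d, (P d).fst = d.fst := by
    intro d
    by_cases h1 : d = a
    · rw [h1, Pa]
    by_cases h2 : d = b
    · rw [h2, Pb]
    by_cases h3 : R.σ d = a
    · rw [P1 d h3 h1, R.tail_fixed, ← h3, R.tail_fixed]
    by_cases h4 : R.σ d = b
    · rw [P2 d h4 h2, R.tail_fixed, ← h4, R.tail_fixed]
    rw [P0 d h1 h2 h3 h4, R.tail_fixed]
  have Pcyc : ∀ (n : ℕ) (d d' : H.Dart), d ≠ a → d ≠ b → d' ≠ a → d' ≠ b →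
      (R.σ ^ n) d = d' → P.SameCycle d d' := by
    intro n
    induction n using Nat.strong_induction_on with
    | _ n ih =>
      intro d d' h1 h2 h1' h2' hn
      match n, ih, hn with
      | 0, _, hn => rw [show d = d' from hn]
      | n + 1, ih, hn =>
        rw [pow_succ, Equiv.Perm.mul_apply] at hn
        by_cases h3 : R.σ d = a
        · rw [h3] at hn
          match n, ih, hn with
          | 0, _, hn => exact absurd hn.symm h1'
          | n + 1, ih, hn =>
            rw [pow_succ, Equiv.Perm.mul_apply] at hn
            have hp := (Pmem d).2 ⟨h1, h2⟩
            rw [← P1 d h3 h1] at hn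
            exact (Equiv.Perm.sameCycle_apply_left).1 (ih n (by omega) _ d' hp.1 hp.2 h1' h2' hn)
        by_cases h4 : R.σ d = b
        · rw [h4] at hn
          match n, ih, hn with
          | 0, _, hn => exact absurd hn.symm h2'
          | n + 1, ih, hn =>
            rw [pow_succ, Equiv.Perm.mul_apply] at hn
            have hp := (Pmem d).2 ⟨h1, h2⟩
            rw [← P2 d h4 h2] at hn
            exact (Equiv.Perm.sameCycle_apply_left).1 (ih n (by omega) _ d' hp.1 hp.2 h1' h2' hn)
        have hp := (Pmem d).2 ⟨h1, h2⟩
        rw [← P0 d h1 h2 h3 h4] at hn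
        exact (Equiv.Perm.sameCycle_apply_left).1 (ih n (by omega) _ d' hp.1 hp.2 h1' h2' hn)
  -- darts of G
  let j : G.Dart → H.Dart := fun d => ⟨(e d.fst, e d.snd), ((hG _ _).1 d.adj).1⟩
  have jinj : Function.Injective j := by
    intro d d' h
    have h1 := congrArg (fun t : H.Dart => t.fst) h
    have h2 := congrArg (fun t : H.Dart => t.snd) h
    exact Dart.ext _ _ (Prod.ext (e.injective h1) (e.injective h2))
  have jmem : ∀ d, j d ≠ a ∧ j d ≠ b := by
    intro d
    have h := ((hG _ _).1 d.adj).2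
    constructor
    · intro h'
      apply h
      rw [← h']
    · intro h'
      apply h
      have : a = (j d).symm := by rw [h', hb, Dart.symm_symm]
      rw [this]
      exact Sym2.eq_swap
  have jsurj : ∀ d : H.Dart, d ≠ a → d ≠ b → ∃ d', j d' = d := by
    intro d h1 h2
    refine ⟨⟨(e.symm d.fst, e.symm d.snd), ?_⟩, ?_⟩
    · show G.Adj _ _
      rw [hG]
      simp only [Equiv.apply_symm_apply]
      refine ⟨d.adj, ?_⟩
      intro h
      rw [Sym2.eq_iff] at h
      rcases h with h | h
      · exact h1 (Dart.ext _ _ (Prod.ext h.1 h.2))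
      · exact h2 (by rw [hb]; exact Dart.ext _ _ (Prod.ext h.1 h.2))
    · apply Dart.ext
      simp [j]
  let ε : G.Dart ≃ {d : H.Dart // d ≠ a ∧ d ≠ b} :=
    Equiv.ofBijective (fun d => ⟨j d, jmem d⟩) ⟨fun d d' h => jinj (congrArg Subtype.val h), by
      rintro ⟨d, h1, h2⟩
      obtain ⟨d', hd'⟩ := jsurj d h1 h2
      exact ⟨d', Subtype.ext hd'⟩⟩
  have hε : ∀ d, (ε d).1 = j d := fun d => rfl
  let S : Equiv.Perm G.Dart := (ε.trans (P.subtypePerm Pmem)).trans ε.symm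
  have hS : ∀ d, j (S d) = P (j d) := by
    intro d
    rw [← hε]
    simp only [S, Equiv.trans_apply, Equiv.apply_symm_apply]
    rfl
  have hSn : ∀ (T : Equiv.Perm G.Dart) (Q : Equiv.Perm H.Dart), (∀ d, j (T d) = Q (j d)) →
      ∀ (n : ℕ) d, j ((T ^ n) d) = (Q ^ n) (j d) := by
    intro T Q hT n
    induction n with
    | zero => intro d; rfl
    | succ n ih =>
      intro d
      rw [pow_succ, pow_succ, Equiv.Perm.mul_apply, Equiv.Perm.mul_apply, ih, hT]
  have hSc : ∀ (T : Equiv.Perm G.Dart) (Q : Equiv.Perm H.Dart), (∀ d, j (T d) = Q (j d)) →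
      ∀ d d', Q.SameCycle (j d) (j d') → T.SameCycle d d' := by
    intro T Q hT d d' h
    obtain ⟨n, hn⟩ := h.exists_nat_pow_eq
    refine ⟨n, ?_⟩
    rw [zpow_natCast]
    apply jinj
    rw [hSn T Q hT, hn]
  let R' : RotationSystem G :=
    { σ := S
      tail_fixed := by
        intro d
        apply e.injective
        have := Pfst (j d)
        rw [← hS] at this
        exact this
      vertex_cycles := by
        intro d d' h
        apply hSc S P hS
        obtain ⟨n, hn⟩ := (R.vertex_cycles (j d) (j d') (congrArg e h)).exists_nat_pow_eq
        exact Pcyc n _ _ (jmem d).1 (jmem d).2 (jmem d').1 (jmem d').2 hn }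
  -- face permutation
  let Q : Equiv.Perm H.Dart := P * dartRev H
  have hQ : ∀ d, j (R'.φ d) = Q (j d) := fun d => hS d.symm
  have hQs : ∀ d : H.Dart, Q d = P d.symm := fun d => rfl
  have symm_a : ∀ d : H.Dart, d ≠ b → d.symm ≠ a := by
    intro d h h'; exact h (by rw [hb, ← h', Dart.symm_symm])
  have symm_b : ∀ d : H.Dart, d ≠ a → d.symm ≠ b := by
    intro d h h'; exact h (Dart.symm_involutive.injective (h'.trans hb))
  have Qmem : ∀ d, d ≠ a → d ≠ b → Q d ≠ a ∧ Q d ≠ b := by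
    intro d h1 h2
    rw [hQs]
    exact (Pmem _).2 ⟨symm_a d h2, symm_b d h1⟩
  have Q1 : ∀ d, d ≠ a → d ≠ b → R.φ d = a → Q d = R.φ b := by
    intro d h1 h2 h
    rw [hQs, P1 d.symm h (symm_a d h2), hσa]
  have Q2 : ∀ d, d ≠ a → d ≠ b → R.φ d = b → Q d = R.φ a := by
    intro d h1 h2 h
    rw [hQs, P2 d.symm h (symm_b d h1), hσb]
  have Q0 : ∀ d, d ≠ a → d ≠ b → R.φ d ≠ a → R.φ d ≠ b → Q d = R.φ d := by
    intro d h1 h2 h h'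
    rw [hQs, P0 d.symm (symm_a d h2) (symm_b d h1) h h', hφs]
  have faceA : ∀ d, R.φ.SameCycle a d → d = a ∨ d = d2 ∨ d = d3 := by
    intro d h
    obtain ⟨n, hn⟩ := h.exists_nat_pow_eq
    clear h
    induction n generalizing d with
    | zero => exact Or.inl hn.symm
    | succ n ih =>
      rw [pow_succ', Equiv.Perm.mul_apply] at hn
      rcases ih _ rfl with h | h | h <;> rw [h] at hn
      · exact Or.inr (Or.inl (by rw [← hn, hd2]))
      · exact Or.inr (Or.inr (by rw [← hn, hd3]))
      · exact Or.inl (by rw [← hn, hd1])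
  have nAB : ¬ R.φ.SameCycle a b := by
    intro h
    rcases faceA b h with h | h | h
    · exact hab h.symm
    · exact h2b h.symm
    · exact h3b h.symm
  have A2 : R.φ.SameCycle a d2 := by rw [hd2]; exact (Equiv.Perm.SameCycle.refl _ _).apply_right
  have A3 : R.φ.SameCycle a d3 := by rw [hd3]; exact A2.apply_right
  have hφba : R.φ b ≠ a := by
    intro h; apply nAB; rw [← h]; exact (Equiv.Perm.SameCycle.refl _ _).apply_left
  have hφbb : R.φ b ≠ b := by
    intro h
    have := hfst b
    rw [h] at this
    exact b.adj.ne this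
  have Qd2 : Q d2 = d3 := by
    rw [Q0 d2 h2a h2b (by rw [← hd3]; exact h3a) (by rw [← hd3]; exact h3b), hd3]
  have Qd3 : Q d3 = R.φ b := Q1 d3 h3a h3b hd1
  have Qcyc : ∀ (n : ℕ) (d d' : H.Dart), ¬ R.φ.SameCycle a d → d ≠ b → d' ≠ b →
      (R.φ ^ n) d = d' → Q.SameCycle d d' := by
    intro n
    induction n using Nat.strong_induction_on with
    | _ n ih =>
      intro d d' h1 h2 h2' hn
      have hda : d ≠ a := by rintro rfl; exact h1 (Equiv.Perm.SameCycle.refl _ _)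
      match n, ih, hn with
      | 0, _, hn => rw [show d = d' from hn]
      | n + 1, ih, hn =>
        rw [pow_succ, Equiv.Perm.mul_apply] at hn
        have h3 : R.φ d ≠ a := by
          intro h; apply h1; rw [← h]; exact (Equiv.Perm.SameCycle.refl _ _).apply_left
        by_cases h4 : R.φ d = b
        · rw [h4] at hn
          match n, ih, hn with
          | 0, _, hn => exact absurd hn.symm h2'
          | n + 1, ih, hn =>
            rw [pow_succ, Equiv.Perm.mul_apply] at hn
            have e1 : Q (Q (Q d)) = R.φ b := by
              rw [Q2 d hda h2 h4, ← hd2, Qd2, Qd3]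
            have := ih n (by omega) _ d' (by
              rw [Equiv.Perm.sameCycle_apply_right]; exact nAB) hφbb h2' hn
            rw [← e1, Equiv.Perm.sameCycle_apply_left, Equiv.Perm.sameCycle_apply_left,
              Equiv.Perm.sameCycle_apply_left] at this
            exact this
        · have := ih n (by omega) _ d' (by
              rw [Equiv.Perm.sameCycle_apply_right]; exact h1) h4 h2' hn
          rw [← Q0 d hda h2 h3 h4, Equiv.Perm.sameCycle_apply_left] at this
          exact this
  let cls : H.Dart → R.Faces := fun d => Quotient.mk R.faceSetoid d
  have cls_eq : ∀ d d', cls d = cls d' ↔ R.φ.SameCycle d d' := fun d d' => Quotient.eq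
  let m : H.Dart → R.Faces := fun d => if R.φ.SameCycle a d then cls b else cls d
  have mA : ∀ d, R.φ.SameCycle a d → m d = cls b := fun d h => if_pos h
  have mN : ∀ d, ¬ R.φ.SameCycle a d → m d = cls d := fun d h => if_neg h
  have hmQ : ∀ d, d ≠ a → d ≠ b → m (Q d) = m d := by
    intro d h1 h2
    by_cases h3 : R.φ d = a
    · have : R.φ.SameCycle a d := by
        rw [← h3]; exact (Equiv.Perm.SameCycle.refl _ _).apply_left
      rw [Q1 d h1 h2 h3, mA d this, mN _ (by rw [Equiv.Perm.sameCycle_apply_right]; exact nAB),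
        cls_eq]
      exact (Equiv.Perm.SameCycle.refl _ _).apply_left
    by_cases h4 : R.φ d = b
    · have h5 : R.φ.SameCycle b d := by
        rw [← h4]; exact (Equiv.Perm.SameCycle.refl _ _).apply_left
      rw [Q2 d h1 h2 h4, ← hd2, mA d2 A2, mN d (fun h => nAB (h.trans h5.symm)), cls_eq]
      exact h5
    rw [Q0 d h1 h2 h3 h4]
    by_cases h5 : R.φ.SameCycle a d
    · rw [mA d h5, mA _ h5.apply_right]
    · rw [mN d h5, mN _ (by rw [Equiv.Perm.sameCycle_apply_right]; exact h5), cls_eq]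
      exact (Equiv.Perm.SameCycle.refl _ _).apply_left
  have toB : ∀ d, R.φ.SameCycle a d → d ≠ a → Q.SameCycle (R.φ b) d := by
    intro d h h'
    rcases faceA d h with h | h | h
    · exact absurd h h'
    · rw [h, ← Qd3, ← Qd2, Equiv.Perm.sameCycle_apply_left, Equiv.Perm.sameCycle_apply_left]
    · rw [h, ← Qd3, Equiv.Perm.sameCycle_apply_left]
  have toB2 : ∀ d, ¬ R.φ.SameCycle a d → d ≠ b → cls b = cls d → Q.SameCycle (R.φ b) d := by
    intro d h h' hc
    rw [cls_eq, ← Equiv.Perm.sameCycle_apply_left] at hc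
    obtain ⟨n, hn⟩ := hc.exists_nat_pow_eq
    exact Qcyc n _ _ (by rw [Equiv.Perm.sameCycle_apply_right]; exact nAB) hφbb h' hn
  have minj : ∀ d d', d ≠ a → d ≠ b → d' ≠ a → d' ≠ b → m d = m d' → Q.SameCycle d d' := by
    intro d d' h1 h2 h1' h2' h
    by_cases h5 : R.φ.SameCycle a d
    · by_cases h6 : R.φ.SameCycle a d'
      · exact (toB d h5 h1).symm.trans (toB d' h6 h1')
      · rw [mA d h5, mN d' h6] at h
        exact (toB d h5 h1).symm.trans (toB2 d' h6 h2' h)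
    · by_cases h6 : R.φ.SameCycle a d'
      · rw [mN d h5, mA d' h6] at h
        exact (toB2 d h5 h2 h.symm).symm.trans (toB d' h6 h1')
      · rw [mN d h5, mN d' h6, cls_eq] at h
        obtain ⟨n, hn⟩ := h.exists_nat_pow_eq
        exact Qcyc n _ _ h5 h2 h2' hn
  have mne : ∀ d, m d ≠ cls a := by
    intro d h
    by_cases h5 : R.φ.SameCycle a d
    · rw [mA d h5, cls_eq] at h
      exact nAB h.symm
    · rw [mN d h5, cls_eq] at h
      exact h5 h.symm
  have mpow : ∀ (n : ℕ) d, m (j ((R'.φ ^ n) d)) = m (j d) := by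
    intro n
    induction n with
    | zero => intro d; rfl
    | succ n ih =>
      intro d
      rw [pow_succ, Equiv.Perm.mul_apply, ih, hQ, hmQ _ (jmem d).1 (jmem d).2]
  let M : R'.Faces → R.Faces := Quotient.lift (s := R'.faceSetoid) (fun d => m (j d)) (by
    intro d d' h
    obtain ⟨n, hn⟩ := Equiv.Perm.SameCycle.exists_nat_pow_eq (f := R'.φ) h
    show m (j d) = m (j d')
    rw [← hn, mpow])
  let N : Option R'.Faces → R.Faces := fun o => o.elim (cls a) M
  have hN : Function.Bijective N := by
    constructor
    · intro o o' h
      match o, o', h with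
      | none, none, _ => rfl
      | none, some f, h =>
        induction f using Quotient.inductionOn with
        | _ d => exact absurd h.symm (mne (j d))
      | some f, none, h =>
        induction f using Quotient.inductionOn with
        | _ d => exact absurd h (mne (j d))
      | some f, some f', h =>
        induction f using Quotient.inductionOn with
        | _ d =>
          induction f' using Quotient.inductionOn with
          | _ d' =>
            congr 1
            apply Quotient.sound
            exact hSc R'.φ Q hQ d d' (minj _ _ (jmem d).1 (jmem d).2 (jmem d').1 (jmem d').2 h)
    · intro f
      induction f using Quotient.inductionOn with
      | _ d =>
        by_cases h : R.φ.SameCycle a d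
        · exact ⟨none, (cls_eq a d).2 h⟩
        · have hda : d ≠ a := by rintro rfl; exact h (Equiv.Perm.SameCycle.refl _ _)
          by_cases hdb : d = b
          · obtain ⟨d', hd'⟩ := jsurj _ hφba hφbb
            refine ⟨some (Quotient.mk _ d'), ?_⟩
            show m (j d') = cls d
            rw [hd', mN _ (by rw [Equiv.Perm.sameCycle_apply_right]; exact nAB), cls_eq, hdb]
            exact (Equiv.Perm.SameCycle.refl _ _).apply_left
          · obtain ⟨d', hd'⟩ := jsurj d hda hdb
            refine ⟨some (Quotient.mk _ d'), ?_⟩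
            show m (j d') = cls d
            rw [hd', mN _ h]
  have hfin : Finite R'.Faces := Quotient.finite _
  have hF : R.numFaces = R'.numFaces + 1 := by
    rw [RotationSystem.numFaces, RotationSystem.numFaces, ← Finite.card_option]
    exact (Nat.card_eq_of_bijective N hN).symm
  -- components
  have hadj : ∀ u v, H.Adj u v → s(u, v) ≠ s(a.fst, a.snd) → G.Adj (e.symm u) (e.symm v) := by
    intro u v h h'
    rw [hG]
    rw [Equiv.apply_symm_apply, Equiv.apply_symm_apply]
    exact ⟨h, h'⟩
  have r2 : G.Adj (e.symm a.snd) (e.symm d2.snd) := by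
    apply hadj
    · rw [← f2]; exact d2.adj
    · intro h
      rw [Sym2.eq_iff] at h
      rcases h with h | h
      · exact na h.1.symm
      · exact n3 (by rw [f3, f1, h.2])
  have r3 : G.Adj (e.symm d2.snd) (e.symm a.fst) := by
    apply hadj
    · rw [← f3, ← f1]; exact d3.adj
    · intro h
      rw [Sym2.eq_iff] at h
      rcases h with h | h
      · exact na h.2
      · exact n2 (by rw [f2, h.1])
  have rab : G.Reachable (e.symm a.fst) (e.symm a.snd) := (r2.reachable.trans r3.reachable).symm
  have hreach : ∀ p q, G.Reachable p q ↔ H.Reachable (e p) (e q) := by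
    intro p q
    constructor
    · rintro ⟨w⟩
      exact ⟨w.map (⟨e, fun h => ((hG _ _).1 h).1⟩ : G →g H)⟩
    · have key : ∀ u v, H.Walk u v → G.Reachable (e.symm u) (e.symm v) := by
        intro u v w
        induction w with
        | nil => exact Reachable.refl _
        | @cons u v w h _ ih =>
          refine Reachable.trans ?_ ih
          by_cases h' : s(u, v) = s(a.fst, a.snd)
          · rw [Sym2.eq_iff] at h'
            rcases h' with ⟨rfl, rfl⟩ | ⟨rfl, rfl⟩
            · exact rab
            · exact rab.symm
          · exact (hadj u v h h').reachable
      rintro ⟨w⟩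
      simpa using key _ _ w
  have hC : Nat.card G.ConnectedComponent = Nat.card H.ConnectedComponent :=
    Nat.card_congr (Quot.congr e hreach)
  refine ⟨R', ?_⟩
  unfold RotationSystem.IsPlanarEmbedding at hR ⊢
  have := Fintype.card_congr e
  omega

theorem edges_delete {V W : Type*} [Fintype V] [Fintype W] (H : SimpleGraph V)
    (G : SimpleGraph W) (e : W ≃ V) (x y : V) (hxy : H.Adj x y)
    (hG : ∀ p q, G.Adj p q ↔ H.Adj (e p) (e q) ∧ s(e p, e q) ≠ s(x, y)) :
    Nat.card H.edgeSet = Nat.card G.edgeSet + 1 := by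
  classical
  have h1 := Set.ncard_sdiff_singleton_add_one (s := H.edgeSet) (a := s(x, y)) hxy
  have h2 : H.edgeSet \ {s(x, y)} = Sym2.map e '' G.edgeSet := by
    ext t
    constructor
    · rintro ⟨h, h'⟩
      induction t using Sym2.ind with
      | _ u v =>
        refine ⟨s(e.symm u, e.symm v), ?_, by simp⟩
        rw [SimpleGraph.mem_edgeSet, hG, Equiv.apply_symm_apply, Equiv.apply_symm_apply]
        exact ⟨h, h'⟩
    · rintro ⟨t, h, rfl⟩
      induction t using Sym2.ind with
      | _ u v =>
        exact (hG u v).1 h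
  rw [h2, Set.ncard_image_of_injective _ (Sym2.map.injective e.injective)] at h1
  exact h1.symm

theorem good_delete {V W : Type*} [Fintype V] [Fintype W] (H : SimpleGraph V)
    (G : SimpleGraph W) (e : W ≃ V) (a : H.Dart)
    (hG : ∀ p q, G.Adj p q ↔ H.Adj (e p) (e q) ∧ s(e p, e q) ≠ s(a.fst, a.snd))
    (hH : GoodGraph H) (d1 : vdeg H a.fst = 4) (d2 : vdeg H a.snd = 4) (hp : IsPlanar G) :
    GoodGraph G := by
  classical
  obtain ⟨-, ⟨hle, v0, hv0⟩, hdia, hhou, h6⟩ := hH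
  let f : G →g H := ⟨e, fun h => ((hG _ _).1 h).1⟩
  have finj : Function.Injective f := e.injective
  have hdeg : ∀ p, vdeg G p ≤ vdeg H (e p) := by
    intro p
    refine Nat.card_le_card_of_injective (fun q : G.neighborSet p => (⟨e q.1, ((hG _ _).1 q.2).1⟩ :
      H.neighborSet (e p))) ?_
    intro q q' h
    exact Subtype.ext (e.injective (congrArg Subtype.val h))
  have hdeg' : ∀ p, e p ≠ a.fst → e p ≠ a.snd → vdeg H (e p) ≤ vdeg G p := by
    intro p h1 h2
    refine Nat.card_le_card_of_injective (fun q : H.neighborSet (e p) => (⟨e.symm q.1, ?_⟩ :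
      G.neighborSet p)) ?_
    · rw [SimpleGraph.mem_neighborSet, hG, Equiv.apply_symm_apply]
      refine ⟨q.2, fun h => ?_⟩
      rw [Sym2.eq_iff] at h
      rcases h with h | h
      · exact h1 h.1
      · exact h2 h.1
    · intro q q' h
      exact Subtype.ext (e.symm.injective (congrArg Subtype.val h))
  have hset : ∀ {p : W} (c₁ c₂ : G.Walk p p), {t | t ∈ c₁.edges} ≠ {t | t ∈ c₂.edges} →
      {t | t ∈ (c₁.map f).edges} ≠ {t | t ∈ (c₂.map f).edges} := by
    intro p c₁ c₂ h h'
    apply h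
    have key : ∀ c : G.Walk p p, {t | t ∈ (c.map f).edges} = Sym2.map f '' {t | t ∈ c.edges} := by
      intro c
      ext t
      simp [SimpleGraph.Walk.edges_map]
    rw [key, key] at h'
    exact (Set.image_injective.2 (Sym2.map.injective finj)) h'
  refine ⟨hp, ⟨fun p => (hdeg p).trans (hle _), e.symm v0, ?_⟩, ?_, ?_, ?_⟩
  · have h1 := hdeg (e.symm v0)
    have h2 := hdeg' (e.symm v0)
    rw [Equiv.apply_symm_apply] at h1 h2
    have h3 := h2 (by rintro rfl; omega) (by rintro rfl; omega)
    omega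
  · rintro ⟨g, gi, hg⟩
    exact hdia ⟨e ∘ g, e.injective.comp gi, fun u v h => ((hG _ _).1 (hg h)).1⟩
  · rintro ⟨g, gi, hg⟩
    exact hhou ⟨e ∘ g, e.injective.comp gi, fun u v h => ((hG _ _).1 (hg h)).1⟩
  · intro p hp6
    have : vdeg H (e p) = 6 := by
      have h1 := hdeg p
      have h2 := hle (e p)
      omega
    rcases h6 _ this with h | h
    · left
      rintro ⟨c₁, c₂, i1, i2, l1, l2, hne, t, t1, t2⟩
      apply h
      refine ⟨c₁.map f, c₂.map f, i1.map finj, i2.map finj, by rw [Walk.length_map, l1],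
        by rw [Walk.length_map, l2], hset _ _ hne, Sym2.map f t, ?_, ?_⟩
      · rw [Walk.edges_map]; exact List.mem_map_of_mem t1
      · rw [Walk.edges_map]; exact List.mem_map_of_mem t2
    · right
      rintro k q l hm ⟨c₁, c₂, c₃, i1, i2, i3, l1, l2, l3, n1, n2, n3⟩
      apply h k q l hm
      exact ⟨c₁.map f, c₂.map f, c₃.map f, i1.map finj, i2.map finj, i3.map finj,
        by rw [Walk.length_map, l1], by rw [Walk.length_map, l2], by rw [Walk.length_map, l3],
        hset _ _ n1, hset _ _ n2, hset _ _ n3⟩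

/-- **Lemma.** A minimal counterexample has no (4,4,4)-face: no 3-face all of whose
incident vertices have degree 4. -/
theorem minimal_counterexample_no_444_face
    {V : Type*} [Fintype V] (H : SimpleGraph V)
    (hmin : MinimalCounterexample H)
    (R : RotationSystem H) (hR : R.IsPlanarEmbedding) :
    ¬ ∃ d : H.Dart, R.faceDeg d = 3 ∧ ∀ v, R.FaceIncident v d → vdeg H v = 4 := by
  rintro ⟨a, h3, h4⟩
  obtain ⟨hgood, hnc, hmini⟩ := hmin
  have hfst : ∀ d, (R.φ d).fst = d.snd := fun d => R.tail_fixed d.symm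
  have hφ := face_three H R a h3
  have dx : vdeg H a.fst = 4 := h4 _ ⟨a, Equiv.Perm.SameCycle.refl _ _, rfl⟩
  have dy : vdeg H a.snd = 4 :=
    h4 _ ⟨R.φ a, (Equiv.Perm.SameCycle.refl _ _).apply_right, hfst a⟩
  have dz : vdeg H (R.φ a).snd = 4 :=
    h4 _ ⟨R.φ (R.φ a), (Equiv.Perm.SameCycle.refl _ _).apply_right.apply_right, hfst _⟩
  have hyz : H.Adj a.snd (R.φ a).snd := by rw [← hfst a]; exact (R.φ a).adj
  have hzx : H.Adj (R.φ a).snd a.fst := by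
    have h := (R.φ (R.φ a)).adj
    rw [← hfst (R.φ (R.φ a)), hφ, hfst] at h
    exact h
  let e : Fin (Fintype.card V) ≃ V := (Fintype.equivFin V).symm
  let G : SimpleGraph (Fin (Fintype.card V)) :=
    (H.deleteEdges {s(a.fst, a.snd)}).comap e
  have hG : ∀ p q, G.Adj p q ↔ H.Adj (e p) (e q) ∧ s(e p, e q) ≠ s(a.fst, a.snd) := by
    intro p q
    show (H.deleteEdges {s(a.fst, a.snd)}).Adj (e p) (e q) ↔ _
    rw [SimpleGraph.deleteEdges_adj, Set.mem_singleton_iff]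
  have hE := edges_delete H G e a.fst a.snd a.adj hG
  have hp := planar_delete H G e a hG R hR hφ hE
  have hgG := good_delete H G e a hG hgood dx dy hp
  by_cases hc : TotallyColorable G 7
  · obtain ⟨cv, ce, h1, h2, h3⟩ := hc
    have hadj : ∀ u v, H.Adj u v → s(u, v) ≠ s(a.fst, a.snd) →
        G.Adj (e.symm u) (e.symm v) := by
      intro u v h h'
      rw [hG, Equiv.apply_symm_apply, Equiv.apply_symm_apply]
      exact ⟨h, h'⟩
    apply hnc
    refine extend_coloring H a.fst a.snd (R.φ a).snd a.adj hyz hzx dx dy dz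
      (fun v => cv (e.symm v)) (fun t => ce (Sym2.map e.symm t)) ?_ ?_ ?_
    · intro u v h h'
      exact h1 (hadj u v h h')
    · intro u v w hv hw hne hv' hw'
      refine h2 _ (hadj u v hv hv') _ (hadj u w hw hw') ?_ ⟨e.symm u, by simp, by simp⟩
      intro h
      apply hne
      have h := Sym2.map.injective e.symm.injective h
      exact Sym2.congr_right.1 h
    · intro u v h h'
      exact h3 (hadj u v h h')
  · have := hmini _ G hgG hc
    omega
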